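/- There is a constant c such that for every graph G on n vertices of maximum degree at most 6, there exists a graph H on at most c·n² vertices such that H is a subdivision of G and H admits a unit ball model in R³, i.e., there is an injective map f : V(H) → R³ with u and v adjacent in H if and only if the Euclidean distance between f(u) and f(v) is at most 1. -/

import Mathlib

open SimpleGraph Set Metric

/-- `H` is a subdivision of `G`: there is an injective map `f` of branch vertices and,
for each edge `uv` of `G`, a path in `H` from `f u` to `f v` (the subdivided edge),
such that the paths corresponding to distinct edges are internally disjoint, internal
vertices of the paths avoid the branch vertices, and the vertices and edges of `H` are
exactly those of the branch vertices and subdivision paths. -/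
def IsSubdivisionOf {W V : Type} (H : SimpleGraph W) (G : SimpleGraph V) : Prop :=
  ∃ (f : V → W) (p : ∀ u v : V, G.Adj u v → H.Walk (f u) (f v)),
    Function.Injective f ∧
    (∀ u v (h : G.Adj u v), (p u v h).IsPath) ∧
    (∀ u v (h : G.Adj u v), p v u h.symm = (p u v h).reverse) ∧
    (∀ u v (h : G.Adj u v) (w : W),
      w ∈ (p u v h).support → w ∈ Set.range f → w = f u ∨ w = f v) ∧
    (∀ u v u' v' (h : G.Adj u v) (h' : G.Adj u' v'), s(u, v) ≠ s(u', v') →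
      ∀ w : W, w ∈ (p u v h).support → w ∈ (p u' v' h').support →
        (w = f u ∨ w = f v) ∧ (w = f u' ∨ w = f v')) ∧
    (∀ w : W, w ∈ Set.range f ∨ ∃ u, ∃ v, ∃ h : G.Adj u v, w ∈ (p u v h).support) ∧
    (∀ e ∈ H.edgeSet, ∃ u, ∃ v, ∃ h : G.Adj u v, e ∈ (p u v h).edges)

/-- `H` admits a unit ball model in `ℝ^d`: an injective map `f : V(H) → ℝ^d` such that
two distinct vertices are adjacent iff their images are at Euclidean distance at
most `1`. -/
def HasUnitBallModelIn {W : Type} (d : ℕ) (H : SimpleGraph W) : Prop :=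
  ∃ f : W → EuclideanSpace ℝ (Fin d), Function.Injective f ∧
    ∀ u v : W, H.Adj u v ↔ u ≠ v ∧ dist (f u) (f v) ≤ 1

theorem IsSubdivisionOf.iso {W W' V : Type} {H : SimpleGraph W} {H' : SimpleGraph W'}
    {G : SimpleGraph V} (e : H ≃g H') (h : IsSubdivisionOf H G) : IsSubdivisionOf H' G := by
  obtain ⟨f, p, hf, hp, hrev, hbranch, hdisj, hcover, hedges⟩ := h
  refine ⟨fun v => e (f v), fun u v h => (p u v h).map e.toHom, e.injective.comp hf,
    fun u v h => (hp u v h).map e.injective, ?_, ?_, ?_, ?_, ?_⟩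
  · intro u v h
    dsimp only
    rw [hrev, Walk.reverse_map]
  · intro u v h w hw hwf
    obtain ⟨x, rfl⟩ := e.surjective w
    obtain ⟨y, hy⟩ := hwf
    have hx : x ∈ (p u v h).support := by
      rw [Walk.support_map, List.mem_map] at hw
      obtain ⟨z, hz, hzx⟩ := hw
      exact e.injective hzx ▸ hz
    simpa using hbranch u v h x hx ⟨y, e.injective hy⟩
  · intro u v u' v' h h' hne w hw hw'
    rw [Walk.support_map, List.mem_map] at hw hw'
    obtain ⟨x, hx, rfl⟩ := hw
    obtain ⟨y, hy, hyx⟩ := hw'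
    obtain rfl := e.injective hyx
    have := hdisj u v u' v' h h' hne y hx hy
    exact ⟨this.1.imp (congrArg e) (congrArg e), this.2.imp (congrArg e) (congrArg e)⟩
  · intro w
    obtain ⟨x, rfl⟩ := e.surjective w
    rcases hcover x with ⟨v, rfl⟩ | ⟨u, v, h, hx⟩
    · exact Or.inl ⟨v, rfl⟩
    · refine Or.inr ⟨u, v, h, ?_⟩
      rw [Walk.support_map, List.mem_map]
      exact ⟨x, hx, rfl⟩
  · intro d hd
    induction d using Sym2.ind with
    | _ a b =>
      obtain ⟨x, rfl⟩ := e.surjective a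
      obtain ⟨y, rfl⟩ := e.surjective b
      have hxy : s(x, y) ∈ H.edgeSet := e.map_adj_iff.1 hd
      obtain ⟨u, v, h, hx⟩ := hedges _ hxy
      refine ⟨u, v, h, ?_⟩
      rw [Walk.edges_map, List.mem_map]
      exact ⟨_, hx, rfl⟩

/-- Some walk of `Γ` from `a` to `b` stays inside the vertex set `S`. -/
def JoinedWithin {α : Type} (Γ : SimpleGraph α) (S : Set α) (a b : α) : Prop :=
  ∃ w : Γ.Walk a b, ∀ x ∈ w.support, x ∈ S

namespace JoinedWithin

variable {α : Type} {Γ : SimpleGraph α} {S : Set α} {a b c : α}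

theorem symm (h : JoinedWithin Γ S a b) : JoinedWithin Γ S b a := by
  obtain ⟨w, hw⟩ := h
  exact ⟨w.reverse, by simpa using hw⟩

theorem trans (h : JoinedWithin Γ S a b) (h' : JoinedWithin Γ S b c) : JoinedWithin Γ S a c := by
  obtain ⟨w, hw⟩ := h
  obtain ⟨w', hw'⟩ := h'
  refine ⟨w.append w', fun x hx => ?_⟩
  rw [Walk.mem_support_append_iff] at hx
  exact hx.elim (hw x) (hw' x)

theorem mono {T : Set α} (hST : S ⊆ T) (h : JoinedWithin Γ S a b) : JoinedWithin Γ T a b :=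
  h.imp fun _ hw x hx => hST (hw x hx)

/-- The points of an integer line segment are joined within every set containing the segment. -/
theorem segment {g : ℤ → α} (hg : ∀ t, Γ.Adj (g t) (g (t + 1))) (a b : ℤ)
    (hS : ∀ t, min a b ≤ t → t ≤ max a b → g t ∈ S) : JoinedWithin Γ S (g a) (g b) := by
  wlog hab : a ≤ b generalizing a b
  · exact (this b a (fun t h h' => hS t (by omega) (by omega)) (by omega)).symm
  rw [min_eq_left hab, max_eq_right hab] at hS
  induction b, hab using Int.leInduction with
  | base => exact ⟨.nil, by simpa using hS a le_rfl le_rfl⟩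
  | succ b hab ih =>
    refine (ih fun t h h' => hS t h (by omega)).trans ⟨(hg b).toWalk, ?_⟩
    intro x hx
    simp only [Adj.toWalk, Walk.support_cons, Walk.support_nil, List.mem_cons,
      List.not_mem_nil, or_false] at hx
    rcases hx with rfl | rfl
    · exact hS _ hab (by omega)
    · exact hS _ (by omega) le_rfl

theorem exists_chordless_path (h : JoinedWithin Γ S a b) :
    ∃ w : Γ.Walk a b, w.IsPath ∧ (∀ x ∈ w.support, x ∈ S) ∧
      ∀ x ∈ w.support, ∀ y ∈ w.support, Γ.Adj x y → s(x, y) ∈ w.edges := by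
  classical
  have hex : ∃ n, ∃ w : Γ.Walk a b, w.length = n ∧ ∀ x ∈ w.support, x ∈ S := by
    obtain ⟨w, hw⟩ := h
    exact ⟨_, w, rfl, hw⟩
  obtain ⟨w₀, hlen, hw₀⟩ := Nat.find_spec hex
  have hmin : ∀ w : Γ.Walk a b, (∀ x ∈ w.support, x ∈ S) → w₀.length ≤ w.length := by
    intro w hw
    rw [hlen]
    exact Nat.find_min' hex ⟨w, rfl, hw⟩
  have hSw : ∀ x ∈ w₀.bypass.support, x ∈ S :=
    fun x hx => hw₀ x (w₀.support_bypass_subset_support hx)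
  have hmin' : ∀ w : Γ.Walk a b, (∀ x ∈ w.support, x ∈ S) → w₀.bypass.length ≤ w.length :=
    fun w hw => w₀.length_bypass_le_length.trans (hmin w hw)
  have hpath := w₀.bypass_isPath
  generalize w₀.bypass = w at hSw hmin' hpath
  refine ⟨w, hpath, hSw, ?_⟩
  have key : ∀ i j, i < j → j ≤ w.length → Γ.Adj (w.getVert i) (w.getVert j) →
      s(w.getVert i, w.getVert j) ∈ w.edges := by
    intro i j hij hj hadj
    have hshort := hmin' ((w.take i).append (.cons hadj (w.drop j))) (by
      intro x hx
      rw [Walk.mem_support_append_iff, Walk.support_cons, List.mem_cons] at hx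
      rcases hx with hx | rfl | hx
      · rw [Walk.support_take] at hx
        exact hSw x (List.mem_of_mem_take hx)
      · exact hSw _ (w.getVert_mem_support i)
      · rw [Walk.drop_support_eq_support_drop_min] at hx
        exact hSw x (List.mem_of_mem_drop hx))
    rw [Walk.length_append, Walk.length_cons, Walk.take_length, Walk.drop_length] at hshort
    obtain rfl : j = i + 1 := by omega
    exact w.mk_mem_edges_iff_exists.2 ⟨i, by omega, rfl⟩
  intro x hx y hy hadj
  obtain ⟨i, rfl, hi⟩ := Walk.mem_support_iff_exists_getVert.1 hx
  obtain ⟨j, rfl, hj⟩ := Walk.mem_support_iff_exists_getVert.1 hy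
  rcases lt_trichotomy i j with h | h | h
  · exact key i j h hj hadj
  · exact absurd (h ▸ hadj) (Γ.irrefl)
  · rw [Sym2.eq_swap]
    exact key j i h hi hadj.symm

end JoinedWithin

/-- If the edges of `G` are routed through regions `S u v` of a graph `Γ` such that regions of
distinct edges touch only at common branch vertices, then some induced subgraph of `Γ` is a
subdivision of `G`. -/
theorem exists_induce_isSubdivisionOf {α V : Type} {Γ : SimpleGraph α} {G : SimpleGraph V}
    {f : V → α} (hf : Function.Injective f) {r : V → ℕ} (hr : Function.Injective r)
    {S : V → V → Set α} (hS : ∀ u v, S u v = S v u)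
    (hjoin : ∀ u v, G.Adj u v → JoinedWithin Γ (S u v) (f u) (f v))
    (hff : ∀ u v, ¬ Γ.Adj (f u) (f v))
    (hbranch : ∀ u v, G.Adj u v → ∀ x ∈ S u v, ∀ w, x = f w ∨ Γ.Adj x (f w) → w = u ∨ w = v)
    (hsep : ∀ u v u' v', G.Adj u v → G.Adj u' v' → s(u, v) ≠ s(u', v') →
      ∀ x ∈ S u v, ∀ y ∈ S u' v', x = y ∨ Γ.Adj x y →
        ∃ w, (w = u ∨ w = v) ∧ (w = u' ∨ w = v') ∧ (x = f w ∨ y = f w)) :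
    ∃ T : Set α, (∀ x ∈ T, x ∈ Set.range f ∨ ∃ u v, G.Adj u v ∧ x ∈ S u v) ∧
      IsSubdivisionOf (Γ.induce T) G := by
  choose q hqpath hqS hqchord using fun u v h => (hjoin u v h).exists_chordless_path
  obtain ⟨p, hp, hpS, hpchord, hprev⟩ : ∃ p : ∀ u v, G.Adj u v → Γ.Walk (f u) (f v),
      (∀ u v h, (p u v h).IsPath) ∧ (∀ u v h, ∀ x ∈ (p u v h).support, x ∈ S u v) ∧
      (∀ u v h, ∀ x ∈ (p u v h).support, ∀ y ∈ (p u v h).support, Γ.Adj x y →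
        s(x, y) ∈ (p u v h).edges) ∧
      ∀ u v (h : G.Adj u v), p v u h.symm = (p u v h).reverse := by
    refine ⟨fun u v h => if r u < r v then q u v h else (q v u h.symm).reverse, ?_, ?_, ?_, ?_⟩
    · intro u v h
      dsimp only
      split_ifs
      · exact hqpath u v h
      · exact (hqpath v u h.symm).reverse
    · intro u v h x hx
      dsimp only at hx
      split_ifs at hx
      · exact hqS u v h x hx
      · rw [Walk.support_reverse, List.mem_reverse] at hx
        exact hS u v ▸ hqS v u h.symm x hx
    · intro u v h
      dsimp only
      split_ifs
      · exact hqchord u v h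
      · simpa only [Walk.support_reverse, Walk.edges_reverse, List.mem_reverse] using
          hqchord v u h.symm
    · intro u v h
      have hne : r u ≠ r v := fun h' => h.ne (hr h')
      rcases lt_or_gt_of_ne hne with hlt | hlt
      · simp [hlt, hlt.not_gt]
      · simp [hlt, hlt.not_gt]
  have hmeet : ∀ u v u' v' (h : G.Adj u v) (h' : G.Adj u' v'), s(u, v) ≠ s(u', v') →
      ∀ x ∈ (p u v h).support, x ∈ (p u' v' h').support →
        (x = f u ∨ x = f v) ∧ (x = f u' ∨ x = f v') := by
    intro u v u' v' h h' hne x hx hx'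
    obtain ⟨w, hw, hw', hxw⟩ :=
      hsep u v u' v' h h' hne x (hpS _ _ _ x hx) x (hpS _ _ _ x hx') (Or.inl rfl)
    obtain rfl : x = f w := hxw.elim id id
    exact ⟨hw.imp (congrArg f) (congrArg f), hw'.imp (congrArg f) (congrArg f)⟩
  set T : Set α := {x | x ∈ Set.range f ∨ ∃ u v, ∃ h : G.Adj u v, x ∈ (p u v h).support}
  have hpT : ∀ u v h, ∀ x ∈ (p u v h).support, x ∈ T := fun u v h x hx => Or.inr ⟨u, v, h, hx⟩
  have hsupp : ∀ u v h (x : T), x ∈ ((p u v h).induce T (hpT u v h)).support ↔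
      x.1 ∈ (p u v h).support := by
    intro u v h x
    simp
  have hend : ∀ u v (h : G.Adj u v) w, w = u ∨ w = v → f w ∈ (p u v h).support := by
    rintro u v h w (rfl | rfl)
    · exact Walk.start_mem_support _
    · exact Walk.end_mem_support _
  have hinj : Function.Injective (Embedding.induce T : Γ.induce T ↪g Γ) :=
    (Embedding.induce T).injective
  refine ⟨T, ?_, fun v => ⟨f v, Or.inl ⟨v, rfl⟩⟩, fun u v h => (p u v h).induce T (hpT u v h),
    ?_, ?_, ?_, ?_, ?_, ?_, ?_⟩
  · rintro x (hx | ⟨u, v, h, hx⟩)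
    · exact Or.inl hx
    · exact Or.inr ⟨u, v, h, hpS u v h x hx⟩
  · exact fun u v h => hf (congrArg Subtype.val h)
  · intro u v h
    apply Walk.IsPath.of_map (f := (Embedding.induce T : Γ.induce T ↪g Γ).toHom)
    rw [Walk.map_induce]
    exact hp u v h
  · intro u v h
    apply Walk.map_injective_of_injective (f := (Embedding.induce T : Γ.induce T ↪g Γ).toHom) hinj
    rw [← Walk.reverse_map, Walk.map_induce, Walk.map_induce]
    exact hprev u v h
  · rintro u v h x hx ⟨w, rfl⟩
    rw [hsupp] at hx
    have := hbranch u v h _ (hpS u v h _ hx) w (Or.inl rfl)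
    rcases this with rfl | rfl
    · exact Or.inl rfl
    · exact Or.inr rfl
  · intro u v u' v' h h' hne x hx hx'
    rw [hsupp] at hx hx'
    simpa only [Subtype.ext_iff] using hmeet u v u' v' h h' hne x.1 hx hx'
  · rintro ⟨x, ⟨v, rfl⟩ | ⟨u, v, h, hx⟩⟩
    · exact Or.inl ⟨v, rfl⟩
    · exact Or.inr ⟨u, v, h, (hsupp u v h _).2 hx⟩
  · intro e he
    induction e using Sym2.ind with
    | _ x y =>
      have hadj : Γ.Adj x.1 y.1 := he
      have lift : ∀ u v (h : G.Adj u v), x.1 ∈ (p u v h).support → y.1 ∈ (p u v h).support →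
          s(x, y) ∈ ((p u v h).induce T (hpT u v h)).edges := by
        intro u v h hx hy
        have hxy := hpchord u v h _ hx _ hy hadj
        have hE : (p u v h).edges =
            ((p u v h).induce T (hpT u v h)).edges.map (Sym2.map Subtype.val) :=
          (congrArg Walk.edges (Walk.map_induce (s := T) (p u v h) (hpT u v h))).symm.trans
            (Walk.edges_map _ _)
        rw [hE, List.mem_map] at hxy
        obtain ⟨d, hd, hdxy⟩ := hxy
        have : d = s(x, y) := Sym2.map.injective Subtype.val_injective hdxy
        exact this ▸ hd
      obtain ⟨x, ⟨a, rfl⟩ | ⟨u, v, h, hx⟩⟩ := x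
      · obtain ⟨y, ⟨b, rfl⟩ | ⟨u, v, h, hy⟩⟩ := y
        · exact absurd hadj (hff a b)
        · exact ⟨u, v, h, lift u v h (hend u v h a
            (hbranch u v h y (hpS u v h y hy) a (Or.inr hadj.symm))) hy⟩
      · obtain ⟨y, ⟨b, rfl⟩ | ⟨u', v', h', hy⟩⟩ := y
        · exact ⟨u, v, h, lift u v h hx (hend u v h b
            (hbranch u v h x (hpS u v h x hx) b (Or.inr hadj)))⟩
        · by_cases hne : s(u, v) = s(u', v')
          · refine ⟨u, v, h, lift u v h hx ?_⟩
            rw [Sym2.eq_iff] at hne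
            rcases hne with ⟨rfl, rfl⟩ | ⟨rfl, rfl⟩
            · exact hy
            · have := hprev _ _ h
              dsimp only at hy ⊢
              rw [this, Walk.support_reverse, List.mem_reverse] at hy
              exact hy
          · obtain ⟨w, hw, hw', hxy | hxy⟩ := hsep u v u' v' h h' hne x (hpS u v h x hx) y
              (hpS u' v' h' y hy) (Or.inr hadj)
            · exact ⟨u', v', h', lift u' v' h' (hxy ▸ hend u' v' h' w hw') hy⟩
            · exact ⟨u, v, h, lift u v h hx (hxy ▸ hend u v h w hw)⟩

/-- The `y`-coordinate at which the wire leaving a branch vertex through port `k` climbs. -/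
def portY (k : ℤ) : ℤ := if k = 0 then -2 else if k = 5 then 2 else 0

/-- The `z`-coordinate at which the wire leaving a branch vertex through port `k` starts to climb. -/
def portZ (k : ℤ) : ℤ := if k = 4 then -2 else 0

/-- The grid graph on `ℤ³`: points are adjacent when they differ by a unit coordinate vector. -/
def gridGraph : SimpleGraph (ℤ × ℤ × ℤ) where
  Adj p q := (p.1 - q.1).natAbs + (p.2.1 - q.2.1).natAbs + (p.2.2 - q.2.2).natAbs = 1
  symm := ⟨fun p q h => by omega⟩
  loopless := ⟨fun p h => by omega⟩

/-- The position of the branch vertex with index `i`. -/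
def branchPoint (i : ℤ) : ℤ × ℤ × ℤ := (12 * i + 4, 0, 0)

/-- The wire from the branch vertex `i` through port `k` to the point `(12 * i + 2 * k, 4, Z)`,
as the union of five axis-parallel segments. -/
def arm (i k Z : ℤ) : Set (ℤ × ℤ × ℤ) :=
  {p | (p.1 = 12 * i + 4 ∧ p.2.2 = 0 ∧ min 0 (portY k) ≤ p.2.1 ∧ p.2.1 ≤ max 0 (portY k)) ∨
    (p.1 = 12 * i + 4 ∧ p.2.1 = portY k ∧ portZ k ≤ p.2.2 ∧ p.2.2 ≤ 0) ∨
    (p.2.1 = portY k ∧ p.2.2 = portZ k ∧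
      min (12 * i + 4) (12 * i + 2 * k) ≤ p.1 ∧ p.1 ≤ max (12 * i + 4) (12 * i + 2 * k)) ∨
    (p.1 = 12 * i + 2 * k ∧ p.2.1 = portY k ∧ portZ k ≤ p.2.2 ∧ p.2.2 ≤ Z) ∨
    (p.1 = 12 * i + 2 * k ∧ p.2.2 = Z ∧ portY k ≤ p.2.1 ∧ p.2.1 ≤ 4)}

set_option maxHeartbeats 2000000 in
/-- Wires through distinct ports with distinct heights touch only at a common branch vertex. -/
theorem arm_separated {i k Z i' k' Z' : ℤ} (hk : 0 ≤ k ∧ k < 6) (hk' : 0 ≤ k' ∧ k' < 6)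
    (hZ : 2 ≤ Z) (hZ' : 2 ≤ Z') (hid : 6 * i + k ≠ 6 * i' + k') (_hZZ : Z + 2 ≤ Z' ∨ Z' + 2 ≤ Z)
    {p q : ℤ × ℤ × ℤ} (hp : p ∈ arm i k Z) (hq : q ∈ arm i' k' Z')
    (hpq : p = q ∨ gridGraph.Adj p q) :
    i = i' ∧ (p = branchPoint i ∨ q = branchPoint i) := by
  obtain ⟨x, y, z⟩ := p
  obtain ⟨x', y', z'⟩ := q
  have hd : (x - x').natAbs + (y - y').natAbs + (z - z').natAbs ≤ 1 := by
    rcases hpq with h | h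
    · simp only [Prod.mk.injEq] at h; omega
    · exact le_of_eq h
  clear hpq
  have hd' : (x - x' + (y - y') + (z - z') ≤ 1 ∧ x - x' + (y - y') - (z - z') ≤ 1) ∧
     (x - x' - (y - y') + (z - z') ≤ 1 ∧ x - x' - (y - y') - (z - z') ≤ 1) ∧
     (-(x - x') + (y - y') + (z - z') ≤ 1 ∧ -(x - x') + (y - y') - (z - z') ≤ 1) ∧
     (-(x - x') - (y - y') + (z - z') ≤ 1 ∧ -(x - x') - (y - y') - (z - z') ≤ 1) := by omega
  clear hd
  simp only [arm, Set.mem_ofPred_eq] at hp hq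
  have hi : i = i' := by
    have h1 : 12 * i ≤ x ∧ x ≤ 12 * i + 10 := by clear hq hd'; omega
    have h2 : 12 * i' ≤ x' ∧ x' ≤ 12 * i' + 10 := by clear hp hd'; omega
    clear hp hq
    omega
  subst hi
  refine ⟨rfl, ?_⟩
  have hkk : k ≠ k' := by omega
  simp only [branchPoint, Prod.mk.injEq]
  clear hid
  have hc : ∀ k : ℤ, 0 ≤ k ∧ k < 6 → (k = 0 ∧ portY k = -2 ∧ portZ k = 0) ∨
      (k = 4 ∧ portY k = 0 ∧ portZ k = -2) ∨ (k = 5 ∧ portY k = 2 ∧ portZ k = 0) ∨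
      (1 ≤ k ∧ k ≤ 3 ∧ portY k = 0 ∧ portZ k = 0) := by
    intro k hk
    unfold portY portZ
    split_ifs <;> omega
  have hc1 := hc k hk
  have hc2 := hc k' hk'
  clear hc
  generalize portY k = Y at *
  generalize portZ k = W at *
  generalize portY k' = Y' at *
  generalize portZ k' = W' at *
  rcases hp with hp | hp | hp | hp | hp <;> rcases hq with hq | hq | hq | hq | hq <;>
    rcases hc1 with hc1 | hc1 | hc1 | hc1 <;> rcases hc2 with hc2 | hc2 | hc2 | hc2 <;> omega

/-- The height at which an edge using the half-edges `h` and `h'` is routed. -/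
def edgeLevel (h h' : ℤ) : ℤ := 2 * min h h' + 2

/-- The region of an edge from port `k` of vertex `i` to port `l` of vertex `j`: the two arms,
and a segment connecting their ends. -/
def edgeRegion (i k j l : ℤ) : Set (ℤ × ℤ × ℤ) :=
  arm i k (edgeLevel (6 * i + k) (6 * j + l)) ∪ arm j l (edgeLevel (6 * i + k) (6 * j + l)) ∪
    {p | p.2.1 = 4 ∧ p.2.2 = edgeLevel (6 * i + k) (6 * j + l) ∧
      min (12 * i + 2 * k) (12 * j + 2 * l) ≤ p.1 ∧ p.1 ≤ max (12 * i + 2 * k) (12 * j + 2 * l)}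

theorem edgeRegion_comm (i k j l : ℤ) : edgeRegion i k j l = edgeRegion j l i k := by
  have h : edgeLevel (6 * i + k) (6 * j + l) = edgeLevel (6 * j + l) (6 * i + k) := by
    unfold edgeLevel
    rw [min_comm]
  unfold edgeRegion
  rw [h, min_comm (12 * i + 2 * k), max_comm (12 * i + 2 * k), Set.union_comm (arm i k _)]

theorem gridGraph_adj_x (y z t : ℤ) : gridGraph.Adj (t, y, z) (t + 1, y, z) := by
  simp only [gridGraph]
  omega

theorem gridGraph_adj_y (x z t : ℤ) : gridGraph.Adj (x, t, z) (x, t + 1, z) := by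
  simp only [gridGraph]
  omega

theorem gridGraph_adj_z (x y t : ℤ) : gridGraph.Adj (x, y, t) (x, y, t + 1) := by
  simp only [gridGraph]
  omega

theorem portY_bounds (k : ℤ) : -2 ≤ portY k ∧ portY k ≤ 2 := by
  unfold portY
  split_ifs <;> omega

theorem portZ_bounds (k : ℤ) : -2 ≤ portZ k ∧ portZ k ≤ 0 := by
  unfold portZ
  split_ifs <;> omega

theorem arm_joined {i k Z : ℤ} (hZ : 2 ≤ Z) :
    JoinedWithin gridGraph (arm i k Z) (branchPoint i) (12 * i + 2 * k, 4, Z) := by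
  have hY := portY_bounds k
  have hW := portZ_bounds k
  have h1 := JoinedWithin.segment (S := arm i k Z) (gridGraph_adj_y (12 * i + 4) 0) 0 (portY k)
    fun t h h' => Or.inl ⟨rfl, rfl, h, h'⟩
  have h2 := JoinedWithin.segment (S := arm i k Z) (gridGraph_adj_z (12 * i + 4) (portY k))
    0 (portZ k) fun t h h' => Or.inr (Or.inl ⟨rfl, rfl, by dsimp only; omega, by dsimp only; omega⟩)
  have h3 := JoinedWithin.segment (S := arm i k Z) (gridGraph_adj_x (portY k) (portZ k))
    (12 * i + 4) (12 * i + 2 * k) fun t h h' => Or.inr (Or.inr (Or.inl ⟨rfl, rfl, h, h'⟩))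
  have h4 := JoinedWithin.segment (S := arm i k Z) (gridGraph_adj_z (12 * i + 2 * k) (portY k))
    (portZ k) Z fun t h h' =>
      Or.inr (Or.inr (Or.inr (Or.inl ⟨rfl, rfl, by dsimp only; omega, by dsimp only; omega⟩)))
  have h5 := JoinedWithin.segment (S := arm i k Z) (gridGraph_adj_y (12 * i + 2 * k) Z)
    (portY k) 4 fun t h h' =>
      Or.inr (Or.inr (Or.inr (Or.inr ⟨rfl, rfl, by dsimp only; omega, by dsimp only; omega⟩)))
  exact h1.trans (h2.trans (h3.trans (h4.trans h5)))

theorem edgeRegion_joined {i k j l : ℤ} (hi : 0 ≤ 6 * i + k) (hj : 0 ≤ 6 * j + l) :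
    JoinedWithin gridGraph (edgeRegion i k j l) (branchPoint i) (branchPoint j) := by
  have hZ : 2 ≤ edgeLevel (6 * i + k) (6 * j + l) := by
    unfold edgeLevel
    omega
  have h1 := (arm_joined (i := i) (k := k) hZ).mono
    (show _ ⊆ edgeRegion i k j l from fun p hp => Or.inl (Or.inl hp))
  have h2 := (arm_joined (i := j) (k := l) hZ).mono
    (show _ ⊆ edgeRegion i k j l from fun p hp => Or.inl (Or.inr hp))
  have h3 := JoinedWithin.segment (S := edgeRegion i k j l)
    (gridGraph_adj_x 4 (edgeLevel (6 * i + k) (6 * j + l))) (12 * i + 2 * k) (12 * j + 2 * l)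
    fun t h h' => Or.inr ⟨rfl, rfl, h, h'⟩
  exact h1.trans (h3.trans h2.symm)

theorem arm_bounds {i k Z : ℤ} (hk : 0 ≤ k ∧ k < 6) (hZ : 2 ≤ Z) {p : ℤ × ℤ × ℤ}
    (hp : p ∈ arm i k Z) :
    (12 * i ≤ p.1 ∧ p.1 ≤ 12 * i + 10) ∧ (-2 ≤ p.2.1 ∧ p.2.1 ≤ 4) ∧ -2 ≤ p.2.2 ∧ p.2.2 ≤ Z := by
  have hY := portY_bounds k
  have hW := portZ_bounds k
  rcases hp with hp | hp | hp | hp | hp <;> omega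

theorem arm_level_of_high {i k Z : ℤ} {p : ℤ × ℤ × ℤ} (hp : p ∈ arm i k Z) (h : 3 ≤ p.2.1) :
    p.2.2 = Z := by
  have hY := portY_bounds k
  rcases hp with hp | hp | hp | hp | hp <;> omega

theorem close_of_eq_or_adj {p q : ℤ × ℤ × ℤ} (h : p = q ∨ gridGraph.Adj p q) :
    (p.1 - q.1).natAbs + (p.2.1 - q.2.1).natAbs + (p.2.2 - q.2.2).natAbs ≤ 1 := by
  rcases h with rfl | h
  · simp
  · exact le_of_eq h

theorem edgeRegion_branch {i k j l m : ℤ} (hk : 0 ≤ k ∧ k < 6) (hl : 0 ≤ l ∧ l < 6) (hi : 0 ≤ i)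
    (hj : 0 ≤ j) {p : ℤ × ℤ × ℤ} (hp : p ∈ edgeRegion i k j l)
    (h : p = branchPoint m ∨ gridGraph.Adj p (branchPoint m)) : m = i ∨ m = j := by
  have hd := close_of_eq_or_adj h
  have hZ : 2 ≤ edgeLevel (6 * i + k) (6 * j + l) := by
    unfold edgeLevel
    omega
  simp only [branchPoint] at hd
  rcases hp with (hp | hp) | hp
  · have := arm_bounds hk hZ hp
    omega
  · have := arm_bounds hl hZ hp
    omega
  · have := hp.1
    omega

theorem edgeRegion_bounds {i k j l n : ℤ} (hk : 0 ≤ k ∧ k < 6) (hl : 0 ≤ l ∧ l < 6)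
    (hi : 0 ≤ i ∧ i < n) (hj : 0 ≤ j ∧ j < n) {p : ℤ × ℤ × ℤ} (hp : p ∈ edgeRegion i k j l) :
    (0 ≤ p.1 ∧ p.1 < 12 * n) ∧ (-2 ≤ p.2.1 ∧ p.2.1 ≤ 4) ∧ -2 ≤ p.2.2 ∧ p.2.2 ≤ 12 * n := by
  have hZ : 2 ≤ edgeLevel (6 * i + k) (6 * j + l) ∧
      edgeLevel (6 * i + k) (6 * j + l) ≤ 12 * n := by
    unfold edgeLevel
    omega
  rcases hp with (hp | hp) | hp
  · have := arm_bounds hk hZ.1 hp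
    omega
  · have := arm_bounds hl hZ.1 hp
    omega
  · obtain ⟨h1, h2, h3, h4⟩ := hp
    omega

theorem edgeRegion_separated {i k j l i' k' j' l' : ℤ} (hk : 0 ≤ k ∧ k < 6) (hl : 0 ≤ l ∧ l < 6)
    (hk' : 0 ≤ k' ∧ k' < 6) (hl' : 0 ≤ l' ∧ l' < 6) (hi : 0 ≤ i) (hj : 0 ≤ j) (hi' : 0 ≤ i')
    (hj' : 0 ≤ j') (h₁ : 6 * i + k ≠ 6 * i' + k') (h₂ : 6 * i + k ≠ 6 * j' + l')
    (h₃ : 6 * j + l ≠ 6 * i' + k') (h₄ : 6 * j + l ≠ 6 * j' + l')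
    {p q : ℤ × ℤ × ℤ} (hp : p ∈ edgeRegion i k j l) (hq : q ∈ edgeRegion i' k' j' l')
    (hpq : p = q ∨ gridGraph.Adj p q) :
    ∃ m, (m = i ∨ m = j) ∧ (m = i' ∨ m = j') ∧ (p = branchPoint m ∨ q = branchPoint m) := by
  have hd := close_of_eq_or_adj hpq
  unfold edgeRegion at hp hq
  have hZ : 2 ≤ edgeLevel (6 * i + k) (6 * j + l) := by
    unfold edgeLevel
    omega
  have hZ' : 2 ≤ edgeLevel (6 * i' + k') (6 * j' + l') := by
    unfold edgeLevel
    omega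
  have hZZ : edgeLevel (6 * i + k) (6 * j + l) + 2 ≤ edgeLevel (6 * i' + k') (6 * j' + l') ∨
      edgeLevel (6 * i' + k') (6 * j' + l') + 2 ≤ edgeLevel (6 * i + k) (6 * j + l) := by
    unfold edgeLevel
    omega
  generalize edgeLevel (6 * i + k) (6 * j + l) = Z at *
  generalize edgeLevel (6 * i' + k') (6 * j' + l') = Z' at *
  rcases hp with (hp | hp) | ⟨hp, hpZ, -⟩
  · rcases hq with (hq | hq) | ⟨hq, hqZ, -⟩
    · obtain ⟨rfl, h⟩ := arm_separated hk hk' hZ hZ' h₁ hZZ hp hq hpq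
      exact ⟨i, Or.inl rfl, Or.inl rfl, h⟩
    · obtain ⟨rfl, h⟩ := arm_separated hk hl' hZ hZ' h₂ hZZ hp hq hpq
      exact ⟨i, Or.inl rfl, Or.inr rfl, h⟩
    · have := arm_level_of_high hp (by omega)
      omega
  · rcases hq with (hq | hq) | ⟨hq, hqZ, -⟩
    · obtain ⟨rfl, h⟩ := arm_separated hl hk' hZ hZ' h₃ hZZ hp hq hpq
      exact ⟨j, Or.inr rfl, Or.inl rfl, h⟩
    · obtain ⟨rfl, h⟩ := arm_separated hl hl' hZ hZ' h₄ hZZ hp hq hpq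
      exact ⟨j, Or.inr rfl, Or.inr rfl, h⟩
    · have := arm_level_of_high hp (by omega)
      omega
  · rcases hq with (hq | hq) | ⟨hq, hqZ, -⟩
    · have := arm_level_of_high hq (by omega)
      omega
    · have := arm_level_of_high hq (by omega)
      omega
    · omega

/-- The embedding of the integer grid in Euclidean space. -/
noncomputable def gridPoint (p : ℤ × ℤ × ℤ) : EuclideanSpace ℝ (Fin 3) :=
  !₂[(p.1 : ℝ), (p.2.1 : ℝ), (p.2.2 : ℝ)]

theorem gridPoint_injective : Function.Injective gridPoint := by
  intro p q h
  have h0 := congrArg (fun v : EuclideanSpace ℝ (Fin 3) => v 0) h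
  have h1 := congrArg (fun v : EuclideanSpace ℝ (Fin 3) => v 1) h
  have h2 := congrArg (fun v : EuclideanSpace ℝ (Fin 3) => v 2) h
  simp [gridPoint] at h0 h1 h2
  exact Prod.ext h0 (Prod.ext h1 h2)

theorem int_sq_eq_natAbs {a : ℤ} (h : a.natAbs ≤ 1) : a ^ 2 = a.natAbs := by
  have h1 : -1 ≤ a := by omega
  have h2 : a ≤ 1 := by omega
  interval_cases a <;> simp

theorem int_natAbs_le_one_of_sq {a : ℤ} (h : a ^ 2 ≤ 1) : a.natAbs ≤ 1 := by
  have h1 : -1 ≤ a := by nlinarith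
  have h2 : a ≤ 1 := by nlinarith
  omega

theorem gridGraph_adj_iff (p q : ℤ × ℤ × ℤ) :
    gridGraph.Adj p q ↔ p ≠ q ∧ dist (gridPoint p) (gridPoint q) ≤ 1 := by
  have hdist : dist (gridPoint p) (gridPoint q) ≤ 1 ↔
      (p.1 - q.1) ^ 2 + (p.2.1 - q.2.1) ^ 2 + (p.2.2 - q.2.2) ^ 2 ≤ 1 := by
    rw [EuclideanSpace.dist_eq, Real.sqrt_le_iff, Fin.sum_univ_three]
    simp only [gridPoint, Real.dist_eq, sq_abs, Matrix.cons_val, zero_le_one, true_and, one_pow]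
    exact_mod_cast Iff.rfl
  have hne : p ≠ q ↔ (p.1 - q.1).natAbs + (p.2.1 - q.2.1).natAbs + (p.2.2 - q.2.2).natAbs ≠ 0 := by
    rw [Ne, Prod.ext_iff, Prod.ext_iff]
    omega
  rw [hdist, hne]
  show _ = 1 ↔ _
  generalize p.1 - q.1 = a
  generalize p.2.1 - q.2.1 = b
  generalize p.2.2 - q.2.2 = c
  constructor
  · intro h
    have ha := int_sq_eq_natAbs (a := a) (by omega)
    have hb := int_sq_eq_natAbs (a := b) (by omega)
    have hc := int_sq_eq_natAbs (a := c) (by omega)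
    omega
  · rintro ⟨h, h'⟩
    have ha := int_sq_eq_natAbs (a := a)
      (int_natAbs_le_one_of_sq (by nlinarith [sq_nonneg b, sq_nonneg c]))
    have hb := int_sq_eq_natAbs (a := b)
      (int_natAbs_le_one_of_sq (by nlinarith [sq_nonneg a, sq_nonneg c]))
    have hc := int_sq_eq_natAbs (a := c)
      (int_natAbs_le_one_of_sq (by nlinarith [sq_nonneg a, sq_nonneg b]))
    omega

theorem exists_port_labelling {V : Type} [Finite V] (G : SimpleGraph V) {d : ℕ}
    (hG : ∀ v : V, (G.neighborSet v).ncard ≤ d) :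
    ∃ φ : V → V → ℕ, ∀ u v, G.Adj u v → φ u v < d ∧ ∀ w, G.Adj u w → φ u v = φ u w → v = w := by
  have h : ∀ u, ∃ φ : V → ℕ, ∀ v, G.Adj u v → φ v < d ∧ ∀ w, G.Adj u w → φ v = φ w → v = w := by
    intro u
    classical
    let e := Finite.equivFin (G.neighborSet u)
    refine ⟨fun v => if h : G.Adj u v then e ⟨v, h⟩ else 0, fun v hv => ⟨?_, fun w hw h => ?_⟩⟩
    · dsimp only
      rw [dif_pos hv]
      exact (e ⟨v, hv⟩).isLt.trans_le (hG u)
    · dsimp only at h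
      rw [dif_pos hv, dif_pos hw] at h
      exact congrArg Subtype.val (e.injective (Fin.ext h))
  choose φ hφ using h
  exact ⟨φ, hφ⟩

/-- There is a constant `c` such that every graph `G` on `n`
vertices of maximum degree at most `6` has a subdivision `H` on at most `c·n²`
vertices admitting a unit ball model in `ℝ³`. -/
theorem exists_unitBall_subdivision_of_maxDegree_six :
    ∃ c : ℕ, ∀ (V : Type) [Fintype V] (G : SimpleGraph V),
      (∀ v : V, (G.neighborSet v).ncard ≤ 6) →
      ∃ (m : ℕ) (H : SimpleGraph (Fin m)),
        m ≤ c * (Fintype.card V) ^ 2 ∧ IsSubdivisionOf H G ∧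
          HasUnitBallModelIn 3 H := by
  refine ⟨1428, fun V _ G hG => ?_⟩
  obtain ⟨φ, hφ⟩ := exists_port_labelling G hG
  let r : V → ℕ := fun v => Fintype.equivFin V v
  have hr : Function.Injective r := Fin.val_injective.comp (Fintype.equivFin V).injective
  have hrlt : ∀ v, 0 ≤ (r v : ℤ) ∧ (r v : ℤ) < Fintype.card V :=
    fun v => ⟨by omega, by exact_mod_cast (Fintype.equivFin V v).isLt⟩
  have hport : ∀ u v, G.Adj u v → 0 ≤ (φ u v : ℤ) ∧ (φ u v : ℤ) < 6 := by
    intro u v h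
    have := (hφ u v h).1
    omega
  have hid : ∀ u v u' v', G.Adj u v → G.Adj u' v' →
      6 * (r u : ℤ) + φ u v = 6 * (r u' : ℤ) + φ u' v' → u = u' ∧ v = v' := by
    intro u v u' v' h h' heq
    have h1 := (hφ u v h).1
    have h2 := (hφ u' v' h').1
    obtain rfl : u = u' := hr (by omega)
    exact ⟨rfl, (hφ u v h).2 v' h' (by omega)⟩
  obtain ⟨T, hT, hsub⟩ := exists_induce_isSubdivisionOf (Γ := gridGraph) (G := G)
    (f := fun v => branchPoint (r v)) (r := r)
    (S := fun u v => edgeRegion (r u) (φ u v) (r v) (φ v u))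
    (fun u v h => hr (by simp only [branchPoint, Prod.mk.injEq] at h; omega)) hr
    (fun u v => edgeRegion_comm _ _ _ _)
    (fun u v h => edgeRegion_joined (by omega) (by omega))
    (fun u v h => by simp only [branchPoint, gridGraph] at h; omega)
    (fun u v h p hp w hw => by
      have := edgeRegion_branch (hport u v h) (hport v u h.symm) (hrlt u).1 (hrlt v).1 hp hw
      exact this.imp (fun h => hr (by omega)) (fun h => hr (by omega)))
    (fun u v u' v' h h' hne p hp q hq hpq => by
      rw [Ne, Sym2.eq_iff] at hne
      obtain ⟨m, hm, hm', hb⟩ := edgeRegion_separated (hport u v h) (hport v u h.symm)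
        (hport u' v' h') (hport v' u' h'.symm) (hrlt u).1 (hrlt v).1 (hrlt u').1 (hrlt v').1
        (fun he => hne (Or.inl (hid _ _ _ _ h h' he)))
        (fun he => hne (Or.inr (hid _ _ _ _ h h'.symm he)))
        (fun he => hne (Or.inr (hid _ _ _ _ h.symm h' he).symm))
        (fun he => hne (Or.inl (hid _ _ _ _ h.symm h'.symm he).symm)) hp hq hpq
      rcases hm with rfl | rfl
      · exact ⟨u, Or.inl rfl, hm'.imp (fun h => hr (by omega)) (fun h => hr (by omega)), hb⟩
      · exact ⟨v, Or.inr rfl, hm'.imp (fun h => hr (by omega)) (fun h => hr (by omega)), hb⟩)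
  set n := Fintype.card V with hn
  let B : Finset (ℤ × ℤ × ℤ) :=
    Finset.Ico 0 (12 * (n : ℤ)) ×ˢ Finset.Icc (-2) 4 ×ˢ Finset.Icc (-2) (12 * (n : ℤ))
  have hTB : T ⊆ B := by
    intro p hp
    have hbound : (0 ≤ p.1 ∧ p.1 < 12 * (n : ℤ)) ∧ (-2 ≤ p.2.1 ∧ p.2.1 ≤ 4) ∧
        -2 ≤ p.2.2 ∧ p.2.2 ≤ 12 * (n : ℤ) := by
      rcases hT p hp with ⟨v, rfl⟩ | ⟨u, v, h, hp⟩
      · have := hrlt v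
        simp only [branchPoint]
        omega
      · exact edgeRegion_bounds (hport u v h) (hport v u h.symm) (hrlt u) (hrlt v) hp
    simpa only [B, Finset.coe_product, Set.mem_prod, Finset.coe_Ico, Finset.coe_Icc, Set.mem_Ico,
      Set.mem_Icc] using hbound
  have hfin : Finite T := B.finite_toSet.subset hTB
  have hcard : Nat.card T ≤ 1428 * n ^ 2 := by
    calc Nat.card T ≤ B.card := by
          rw [Nat.card_coe_set_eq, ← Set.ncard_coe_finset]
          exact Set.ncard_le_ncard hTB B.finite_toSet
      _ = 12 * n * (7 * (12 * n + 3)) := by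
          simp only [B, Finset.card_product, Int.card_Ico, Int.card_Icc]
          congr 1
      _ ≤ 1428 * n ^ 2 := by
          rcases Nat.eq_zero_or_pos n with h | h
          · simp [h]
          · nlinarith
  let e : T ≃ Fin (Nat.card T) := Finite.equivFin T
  refine ⟨Nat.card T, (gridGraph.induce T).comap e.symm, hcard,
    hsub.iso (Iso.comap e.symm (gridGraph.induce T)).symm,
    fun a => gridPoint (e.symm a), ?_, fun a b => ?_⟩
  · exact gridPoint_injective.comp (Subtype.val_injective.comp e.symm.injective)
  · have hne : (e.symm a : ℤ × ℤ × ℤ) ≠ e.symm b ↔ a ≠ b :=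
      (Subtype.val_injective.comp e.symm.injective).ne_iff
    rw [← hne]
    exact gridGraph_adj_iff _ _
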